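/- Let K_p, K_d, K_i ∈ ℝ, let P ∈ ℝ^{3×3} be symmetric positive definite, let c₁, c₂ > 0, and for μ ∈ (−1/2,1/2) let g_μ be the hPID closed-loop vector field built from the explicit norm h_μ(ξ₁,ξ₂) = c₁|ξ₁|^{1/(1−μ)} + c₂|ξ₂|. Let A be the 3×3 matrix with rows (0,1,0), (K_p, K_d, 1), (K_i, 0, 0), so that g_0(z) = Az. Then sup{‖g_μ(z) − Az‖ : z ∈ ℝ³, zᵀ P z = 1} → 0 as μ → 0, where ‖·‖ is the Euclidean norm on ℝ³. -/

import Mathlib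

open Matrix Filter

/-- Euclidean norm on `Fin 3 → ℝ`. -/
noncomputable def eucNorm3 (x : Fin 3 → ℝ) : ℝ :=
  Real.sqrt (∑ i, (x i) ^ 2)

/-- The explicit `d_μ`-homogeneous norm `h_μ(ξ₁, ξ₂) = c₁|ξ₁|^{1/(1−μ)} + c₂|ξ₂|`. -/
noncomputable def hmu (c₁ c₂ μ : ℝ) (ξ : Fin 2 → ℝ) : ℝ :=
  c₁ * |ξ 0| ^ (1 / (1 - μ)) + c₂ * |ξ 1|

/-- The hPID closed-loop vector field built from the explicit norm `h_μ`. -/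
noncomputable def gmu (Kp Kd Ki c₁ c₂ μ : ℝ) (x : Fin 3 → ℝ) : Fin 3 → ℝ :=
  ![x 1,
    Kp * hmu c₁ c₂ μ ![x 0, x 1] ^ (2 * μ) * x 0 +
      Kd * hmu c₁ c₂ μ ![x 0, x 1] ^ μ * x 1 + x 2,
    Ki * hmu c₁ c₂ μ ![x 0, x 1] ^ (3 * μ) * x 0]

/-- A factor `h ^ t` with `t → 0` does not destroy continuity of `u` at zeros of `h`, provided
`u` is dominated by a power of `h` with exponent near `1`. -/
lemma continuousAt_rpow_mul_of_abs_le {X : Type*} [TopologicalSpace X] {h t e u : X → ℝ}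
    {a : X} {C : ℝ} (hC : 0 < C) (hh : ContinuousAt h a) (ht : ContinuousAt t a)
    (he : ContinuousAt e a) (hu : ContinuousAt u a) (h_nonneg : ∀ x, 0 ≤ h x)
    (hta : t a = 0) (hea : e a = 1) (hle : ∀ᶠ x in nhds a, |u x| ≤ (C * h x) ^ e x) :
    ContinuousAt (fun x => h x ^ t x * u x) a := by
  by_cases ha : h a = 0
  · have hua : u a = 0 := by
      have := hle.self_of_nhds
      rw [ha, hea] at this
      simpa using this
    have hbound : ContinuousAt (fun x => C ^ e x * h x ^ (e x + t x)) a :=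
      (continuousAt_const.rpow he (Or.inl hC.ne')).mul
        (hh.rpow (he.add ht) (Or.inr (by rw [hta, hea]; norm_num)))
    have hlim : Tendsto (fun x => C ^ e x * h x ^ (e x + t x)) (nhds a) (nhds 0) := by
      have := hbound.tendsto
      simpa [ha, hta, hea] using this
    have hpos : ∀ᶠ x in nhds a, 0 < e x := he.eventually_const_lt (by rw [hea]; norm_num)
    rw [ContinuousAt, hua, mul_zero]
    refine squeeze_zero_norm' ?_ hlim
    filter_upwards [hle, hpos] with x hx hex
    rcases (h_nonneg x).eq_or_lt with h0 | h0
    · have hux : u x = 0 := by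
        rw [← h0, mul_zero, Real.zero_rpow hex.ne'] at hx
        simpa using hx
      rw [hux, mul_zero, norm_zero, ← h0]
      positivity
    · rw [Real.norm_eq_abs, abs_mul, abs_of_nonneg (Real.rpow_nonneg h0.le _)]
      calc h x ^ t x * |u x| ≤ h x ^ t x * (C * h x) ^ e x := by gcongr
        _ = C ^ e x * h x ^ (e x + t x) := by
          rw [Real.mul_rpow hC.le h0.le, Real.rpow_add h0]
          ring
  · exact (hh.rpow ht (Or.inl ha)).mul hu

lemma hmu_nonneg {c₁ c₂ : ℝ} (hc₁ : 0 < c₁) (hc₂ : 0 < c₂) (μ : ℝ) (ξ : Fin 2 → ℝ) :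
    0 ≤ hmu c₁ c₂ μ ξ := by
  unfold hmu
  positivity

lemma abs_fst_le_hmu_rpow {c₁ c₂ μ : ℝ} (hc₁ : 0 < c₁) (hc₂ : 0 < c₂) (hμ : μ < 1)
    (ξ : Fin 2 → ℝ) : |ξ 0| ≤ (c₁⁻¹ * hmu c₁ c₂ μ ξ) ^ (1 - μ) := by
  have hμ' : 0 < 1 - μ := by linarith
  calc |ξ 0| = (|ξ 0| ^ (1 / (1 - μ))) ^ (1 - μ) := by
        rw [← Real.rpow_mul (abs_nonneg _), one_div_mul_cancel hμ'.ne', Real.rpow_one]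
    _ ≤ (c₁⁻¹ * hmu c₁ c₂ μ ξ) ^ (1 - μ) := by
        refine Real.rpow_le_rpow (by positivity) ?_ hμ'.le
        rw [le_inv_mul_iff₀ hc₁, hmu]
        have : 0 ≤ c₂ * |ξ 1| := by positivity
        linarith

lemma abs_snd_le_hmu {c₁ c₂ : ℝ} (hc₁ : 0 < c₁) (hc₂ : 0 < c₂) (μ : ℝ) (ξ : Fin 2 → ℝ) :
    |ξ 1| ≤ c₂⁻¹ * hmu c₁ c₂ μ ξ := by
  rw [le_inv_mul_iff₀ hc₂, hmu]
  have : 0 ≤ c₁ * |ξ 0| ^ (1 / (1 - μ)) := by positivity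
  linarith

lemma continuousAt_hmu (c₁ c₂ : ℝ) (z : Fin 3 → ℝ) :
    ContinuousAt (fun p : ℝ × (Fin 3 → ℝ) => hmu c₁ c₂ p.1 ![p.2 0, p.2 1]) (0, z) := by
  have hexp : ContinuousAt (fun p : ℝ × (Fin 3 → ℝ) => 1 / (1 - p.1)) (0, z) :=
    continuousAt_const.div (by fun_prop) (by simp)
  have habs : ContinuousAt (fun p : ℝ × (Fin 3 → ℝ) => |p.2 0|) (0, z) := by fun_prop
  have hsnd : ContinuousAt (fun p : ℝ × (Fin 3 → ℝ) => c₂ * |p.2 1|) (0, z) := by fun_prop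
  exact ((habs.rpow hexp (Or.inr (by simp))).const_mul c₁).add hsnd

lemma continuousAt_hmu_rpow_mul_fst {c₁ c₂ : ℝ} (hc₁ : 0 < c₁) (hc₂ : 0 < c₂) (k : ℝ)
    (z : Fin 3 → ℝ) :
    ContinuousAt (fun p : ℝ × (Fin 3 → ℝ) =>
      hmu c₁ c₂ p.1 ![p.2 0, p.2 1] ^ (k * p.1) * p.2 0) (0, z) := by
  refine continuousAt_rpow_mul_of_abs_le (e := fun p => 1 - p.1) (inv_pos.2 hc₁)
    (continuousAt_hmu c₁ c₂ z) (by fun_prop) (by fun_prop) (by fun_prop)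
    (fun p => hmu_nonneg hc₁ hc₂ _ _) (by simp) (by simp) ?_
  have hlt : ∀ᶠ p : ℝ × (Fin 3 → ℝ) in nhds (0, z), p.1 < 1 :=
    continuousAt_fst.eventually_lt_const (by norm_num)
  filter_upwards [hlt] with p hp
  exact abs_fst_le_hmu_rpow hc₁ hc₂ hp ![p.2 0, p.2 1]

lemma continuousAt_hmu_rpow_mul_snd {c₁ c₂ : ℝ} (hc₁ : 0 < c₁) (hc₂ : 0 < c₂)
    (z : Fin 3 → ℝ) :
    ContinuousAt (fun p : ℝ × (Fin 3 → ℝ) =>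
      hmu c₁ c₂ p.1 ![p.2 0, p.2 1] ^ p.1 * p.2 1) (0, z) := by
  refine continuousAt_rpow_mul_of_abs_le (e := fun _ => 1) (inv_pos.2 hc₂)
    (continuousAt_hmu c₁ c₂ z) (by fun_prop) (by fun_prop) (by fun_prop)
    (fun p => hmu_nonneg hc₁ hc₂ _ _) rfl rfl (Eventually.of_forall fun p => ?_)
  rw [Real.rpow_one]
  exact abs_snd_le_hmu hc₁ hc₂ p.1 ![p.2 0, p.2 1]

lemma continuousAt_gmu {c₁ c₂ : ℝ} (hc₁ : 0 < c₁) (hc₂ : 0 < c₂) (Kp Kd Ki : ℝ)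
    (z : Fin 3 → ℝ) :
    ContinuousAt (fun p : ℝ × (Fin 3 → ℝ) => gmu Kp Kd Ki c₁ c₂ p.1 p.2) (0, z) := by
  have hfst := fun k => continuousAt_hmu_rpow_mul_fst hc₁ hc₂ k z
  have hsnd := continuousAt_hmu_rpow_mul_snd hc₁ hc₂ z
  have hx : ContinuousAt (fun p : ℝ × (Fin 3 → ℝ) => p.2 2) (0, z) := by fun_prop
  rw [continuousAt_pi]
  intro i
  fin_cases i
  · change ContinuousAt (fun p : ℝ × (Fin 3 → ℝ) => p.2 1) (0, z)
    fun_prop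
  · simpa [gmu, mul_assoc, Pi.add_def] using
      (((hfst 2).const_mul Kp).add (hsnd.const_mul Kd)).add hx
  · simpa [gmu, mul_assoc] using (hfst 3).const_mul Ki

lemma gmu_zero (Kp Kd Ki c₁ c₂ : ℝ) (z : Fin 3 → ℝ) :
    gmu Kp Kd Ki c₁ c₂ 0 z = Matrix.of ![![0, 1, 0], ![Kp, Kd, 1], ![Ki, 0, 0]] *ᵥ z := by
  ext i
  fin_cases i <;> simp [gmu, Matrix.mulVec, dotProduct, Fin.sum_univ_three]

lemma continuous_eucNorm3 : Continuous eucNorm3 := by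
  unfold eucNorm3
  fun_prop

lemma Matrix.PosDef.isCompact_ellipsoid {n : Type*} [Fintype n] {P : Matrix n n ℝ}
    (hP : P.PosDef) : IsCompact {z : n → ℝ | z ⬝ᵥ (P *ᵥ z) = 1} := by
  have hcont : Continuous fun z : n → ℝ => z ⬝ᵥ (P *ᵥ z) := by fun_prop
  refine Metric.isCompact_of_isClosed_isBounded (isClosed_eq hcont continuous_const) ?_
  rcases (Metric.sphere (0 : n → ℝ) 1).eq_empty_or_nonempty with hempty | hne
  · refine (Metric.isBounded_closedBall (x := (0 : n → ℝ)) (r := 0)).subset fun z _ => ?_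
    by_contra hz
    have hz0 : z ≠ 0 := by simpa using hz
    have : ‖z‖⁻¹ • z ∈ Metric.sphere (0 : n → ℝ) 1 := by
      simp [norm_smul, norm_ne_zero_iff.2 hz0]
    simp [hempty] at this
  · obtain ⟨w, hw, hmin⟩ := (isCompact_sphere (0 : n → ℝ) 1).exists_isMinOn hne
      hcont.continuousOn
    have hw0 : w ≠ 0 := by
      rintro rfl
      simp at hw
    have hm : 0 < w ⬝ᵥ (P *ᵥ w) := by simpa using hP.dotProduct_mulVec_pos hw0
    set m := w ⬝ᵥ (P *ᵥ w)
    refine (Metric.isBounded_closedBall (x := (0 : n → ℝ)) (r := √m⁻¹)).subset fun z hz => ?_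
    rw [Set.mem_ofPred_eq] at hz
    have hz0 : z ≠ 0 := by
      rintro rfl
      simp at hz
    have hzn : 0 < ‖z‖ := norm_pos_iff.2 hz0
    have hle : m ≤ (‖z‖⁻¹ • z) ⬝ᵥ (P *ᵥ (‖z‖⁻¹ • z)) :=
      hmin (by simp [norm_smul, hzn.ne'])
    simp only [Matrix.mulVec_smul, smul_dotProduct, dotProduct_smul, hz, smul_eq_mul,
      mul_one] at hle
    rw [mem_closedBall_zero_iff]
    refine Real.le_sqrt_of_sq_le ?_
    rw [le_inv_comm₀ (by positivity) hm, sq, mul_inv]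
    exact hle

/-- with `A` the linear PID closed-loop matrix (rows `(0,1,0)`,
`(K_p,K_d,1)`, `(K_i,0,0)`, so `g₀(z) = Az`), the supremum of `‖g_μ(z) − Az‖` over the
ellipsoid `{z : zᵀPz = 1}` tends to `0` as `μ → 0` within `(−1/2, 1/2)`. -/
theorem sup_gmu_sub_linear_tendsto_zero
    (Kp Kd Ki : ℝ) (P : Matrix (Fin 3) (Fin 3) ℝ) (hP : P.PosDef)
    (c₁ c₂ : ℝ) (hc₁ : 0 < c₁) (hc₂ : 0 < c₂)
    (A : Matrix (Fin 3) (Fin 3) ℝ)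
    (hA : A = Matrix.of ![![0, 1, 0], ![Kp, Kd, 1], ![Ki, 0, 0]]) :
    Tendsto (fun μ : ℝ => sSup {y : ℝ | ∃ z : Fin 3 → ℝ, z ⬝ᵥ (P *ᵥ z) = 1 ∧
        y = eucNorm3 (gmu Kp Kd Ki c₁ c₂ μ z - A *ᵥ z)})
      (nhdsWithin 0 (Set.Ioo (-(1:ℝ)/2) (1/2))) (nhds 0) := by
  refine Tendsto.mono_left ?_ nhdsWithin_le_nhds
  rw [Metric.tendsto_nhds]
  intro ε hε
  have huniform : ∀ᶠ μ in nhds (0 : ℝ), ∀ z ∈ {z : Fin 3 → ℝ | z ⬝ᵥ (P *ᵥ z) = 1},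
      eucNorm3 (gmu Kp Kd Ki c₁ c₂ μ z - A *ᵥ z) < ε / 2 := by
    refine hP.isCompact_ellipsoid.eventually_forall_of_forall_eventually fun z _ => ?_
    have hcont : ContinuousAt (fun p : ℝ × (Fin 3 → ℝ) =>
        eucNorm3 (gmu Kp Kd Ki c₁ c₂ p.1 p.2 - A *ᵥ p.2)) (0, z) :=
      continuous_eucNorm3.continuousAt.comp
        ((continuousAt_gmu hc₁ hc₂ Kp Kd Ki z).sub (by fun_prop))
    refine hcont.eventually_lt_const ?_
    beta_reduce
    rw [gmu_zero, hA, sub_self]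
    simpa [eucNorm3] using hε
  filter_upwards [huniform] with μ hμ
  rw [Real.dist_eq, sub_zero, abs_of_nonneg]
  · refine (Real.sSup_le ?_ (by positivity)).trans_lt (half_lt_self hε)
    rintro y ⟨z, hz, rfl⟩
    exact (hμ z hz).le
  · refine Real.sSup_nonneg ?_
    rintro y ⟨z, -, rfl⟩
    exact Real.sqrt_nonneg _
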